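/- Let ε > 0, let W : (−ε, 1) → ℝ be twice continuously differentiable with W′(0) < 0 and W″(0) > W′(0), and set r₀ = √(−8·W′(0)). Then: (a) there exists η > 0 such that for every r > r₀, U_r′(u) ≠ 0 for all u with 0 < |u| < η (so u = 0 is the only critical point of U_r near 0); (b) there exist δ > 0 and a continuous function β : (r₀ − δ, r₀) → (0, η) such that for every r ∈ (r₀ − δ, r₀), U_r′(β(r)) = 0 and β(r) is a strict local minimum of U_r, and β(r) → 0 as r → r₀ from below. -/

import Mathlib

/-- The function `v(u) = (1 - √(1-u²))/u` for `u ≠ 0`, `v(0) = 0`. -/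
noncomputable def v (u : ℝ) : ℝ := if u = 0 then 0 else (1 - Real.sqrt (1 - u ^ 2)) / u

/-- The effective potential `U_r(u) = (r²/2) v(u)² + W(u²)`. -/
noncomputable def effU (r : ℝ) (W : ℝ → ℝ) (u : ℝ) : ℝ := r ^ 2 / 2 * (v u) ^ 2 + W (u ^ 2)

open Set Filter Topology

/-- A continuous strictly decreasing function on `[0, a]` has a continuous inverse branch, which
tends to `0` at the maximal value. -/
lemma StrictAntiOn.exists_continuousOn_inverse {G : ℝ → ℝ} {a : ℝ} (ha : 0 < a)
    (hG : StrictAntiOn G (Icc 0 a)) (hc : ContinuousOn G (Icc 0 a)) :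
    ∃ b : ℝ → ℝ, ContinuousOn b (Ioo (G a) (G 0)) ∧
      (∀ y ∈ Ioo (G a) (G 0), b y ∈ Ioo 0 a ∧ G (b y) = y) ∧
      Tendsto b (𝓝[<] (G 0)) (𝓝 0) := by
  have h : ∀ y ∈ Ioo (G a) (G 0), ∃ x, x ∈ Ioo 0 a ∧ G x = y := fun y hy =>
    intermediate_value_Ioo' ha.le hc hy
  choose! b hb hGb using h
  have hmem : ∀ y ∈ Ioo (G a) (G 0), b y ∈ Icc 0 a := fun y hy => Ioo_subset_Icc_self (hb y hy)
  refine ⟨b, fun y hy => ContinuousAt.continuousWithinAt ?_, fun y hy => ⟨hb y hy, hGb y hy⟩, ?_⟩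
  · have hnhds : ∀ᶠ z in 𝓝 y, z ∈ Ioo (G a) (G 0) := isOpen_Ioo.mem_nhds hy
    have hby := hb y hy
    refine tendsto_order.2 ⟨fun c hcy => ?_, fun c hcy => ?_⟩
    · have hm : max c 0 ∈ Icc 0 a := ⟨le_max_right _ _, (max_lt hcy hby.1).le.trans hby.2.le⟩
      have hlt : y < G (max c 0) := by
        conv_lhs => rw [← hGb y hy]
        exact hG hm (hmem y hy) (max_lt hcy hby.1)
      filter_upwards [hnhds, Iio_mem_nhds hlt] with z hz hzlt
      rw [mem_Iio, ← hGb z hz, hG.lt_iff_gt (hmem z hz) hm] at hzlt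
      exact (le_max_left _ _).trans_lt hzlt
    · have hm : min c a ∈ Icc 0 a := ⟨hby.1.le.trans (lt_min hcy hby.2).le, min_le_right _ _⟩
      have hlt : G (min c a) < y := by
        conv_rhs => rw [← hGb y hy]
        exact hG (hmem y hy) hm (lt_min hcy hby.2)
      filter_upwards [hnhds, Ioi_mem_nhds hlt] with z hz hzlt
      rw [mem_Ioi, ← hGb z hz, hG.lt_iff_gt hm (hmem z hz)] at hzlt
      exact hzlt.trans_le (min_le_left _ _)
  · have ha0 : G a < G 0 := hG ⟨le_rfl, ha.le⟩ ⟨ha.le, le_rfl⟩ ha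
    have hnhds : ∀ᶠ z in 𝓝[<] (G 0), z ∈ Ioo (G a) (G 0) := Ioo_mem_nhdsLT ha0
    refine tendsto_order.2 ⟨fun c hc0 => ?_, fun c hc0 => ?_⟩
    · filter_upwards [hnhds] with z hz using hc0.trans (hb z hz).1
    · have hm : min c a ∈ Icc 0 a := ⟨(lt_min hc0 ha).le, min_le_right _ _⟩
      have hlt : G (min c a) < G 0 := hG ⟨le_rfl, ha.le⟩ hm (lt_min hc0 ha)
      filter_upwards [hnhds, Ioo_mem_nhdsLT hlt] with z hz hzlt
      have hzlt := hzlt.1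
      rw [← hGb z hz, hG.lt_iff_gt hm (hmem z hz)] at hzlt
      exact hzlt.trans_le (min_le_left _ _)

/-- A function with negative strict derivative at a point is strictly decreasing nearby. -/
lemma HasStrictDerivAt.exists_strictAntiOn {F : ℝ → ℝ} {F' x : ℝ} (h : HasStrictDerivAt F F' x)
    (hF' : F' < 0) : ∃ a > 0, StrictAntiOn F (Ioo (x - a) (x + a)) := by
  have hb := h.hasStrictFDerivAt.isLittleO.bound (half_pos (neg_pos.2 hF'))
  obtain ⟨a, ha, hball⟩ := Metric.eventually_nhds_iff.1 hb
  refine ⟨a, ha, fun s hs t ht hst => ?_⟩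
  have hd : dist (t, s) (x, x) < a := by
    rw [Prod.dist_eq, max_lt_iff, Real.dist_eq, Real.dist_eq, abs_lt, abs_lt]
    obtain ⟨hs1, hs2⟩ := hs
    obtain ⟨ht1, ht2⟩ := ht
    constructor <;> constructor <;> linarith
  have := hball hd
  simp only [ContinuousLinearMap.toSpanSingleton_apply, smul_eq_mul, Real.norm_eq_abs] at this
  rw [abs_of_pos (sub_pos.2 hst)] at this
  nlinarith [(abs_le.1 this).2, mul_pos (neg_pos.2 hF') (sub_pos.2 hst)]

/-- The value of `r²` for which `t = u²` yields a critical point of `effU r W`. -/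
noncomputable def criticalSq (W : ℝ → ℝ) (t : ℝ) : ℝ :=
  -2 * deriv W t * (√(1 - t) * (1 + √(1 - t)) ^ 2)

lemma v_sq {u : ℝ} (hu : |u| < 1) : v u ^ 2 = 2 / (1 + √(1 - u ^ 2)) - 1 := by
  have hu2 : u ^ 2 < 1 := (sq_lt_one_iff_abs_lt_one u).2 hu
  have hs : √(1 - u ^ 2) ^ 2 = 1 - u ^ 2 := Real.sq_sqrt (by linarith)
  have hs0 := Real.sqrt_nonneg (1 - u ^ 2)
  unfold v
  split_ifs with h
  · subst h
    norm_num
  · generalize √(1 - u ^ 2) = s at *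
    have : 1 + s ≠ 0 := by positivity
    field_simp
    rw [show u ^ 2 = 1 - s ^ 2 by linarith]
    ring

lemma hasDerivAt_effU {r u : ℝ} {W : ℝ → ℝ} (hu : |u| < 1) (hW : DifferentiableAt ℝ W (u ^ 2)) :
    HasDerivAt (effU r W) (u * (r ^ 2 - criticalSq W (u ^ 2)) /
      (√(1 - u ^ 2) * (1 + √(1 - u ^ 2)) ^ 2)) u := by
  have hu2 : u ^ 2 < 1 := (sq_lt_one_iff_abs_lt_one u).2 hu
  have hs : 0 < √(1 - u ^ 2) := Real.sqrt_pos.2 (by linarith)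
  have hq : HasDerivAt (fun x : ℝ => x ^ 2) (2 * u) u := by simpa using hasDerivAt_pow 2 u
  have hsq := (hq.const_sub 1).sqrt (by linarith : (1 - u ^ 2) ≠ 0)
  have hv := (((hsq.const_add 1).fun_inv (by positivity)).const_mul 2).sub_const 1
  have hWq : HasDerivAt (fun x => W (x ^ 2)) (deriv W (u ^ 2) * (2 * u)) u :=
    HasDerivAt.comp u hW.hasDerivAt hq
  have hmain := (hv.const_mul (r ^ 2 / 2)).fun_add hWq
  have heq : effU r W =ᶠ[𝓝 u]
      fun x => r ^ 2 / 2 * (2 * (1 + √(1 - x ^ 2))⁻¹ - 1) + W (x ^ 2) := by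
    filter_upwards [continuous_abs.continuousAt.eventually_lt continuousAt_const hu] with x hx
    rw [effU, v_sq hx, div_eq_mul_inv 2 (1 + _)]
  refine (hmain.congr_of_eventuallyEq heq).congr_deriv ?_
  unfold criticalSq
  field_simp
  ring

lemma hasStrictDerivAt_criticalSq {W : ℝ → ℝ} (hW : ContDiffAt ℝ 1 (deriv W) 0) :
    HasStrictDerivAt (criticalSq W) (8 * (deriv W 0 - deriv (deriv W) 0)) 0 := by
  have h1 : HasStrictDerivAt (deriv W) (deriv (deriv W) 0) 0 := hW.hasStrictDerivAt (by simp)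
  have hs : HasStrictDerivAt (fun t : ℝ => √(1 - t)) (1 / (2 * √(1 - 0)) * (-1)) 0 :=
    HasStrictDerivAt.comp (0 : ℝ) (Real.hasStrictDerivAt_sqrt (x := 1 - 0) (by norm_num))
      ((hasStrictDerivAt_id (0 : ℝ)).const_sub 1)
  have h := (h1.const_mul (-2)).fun_mul (hs.fun_mul ((hs.const_add 1).fun_pow 2))
  refine h.congr_deriv ?_
  norm_num
  ring

/-- A function whose derivative changes sign from negative to positive at `b` has a strict local
minimum there. -/
lemma exists_strict_local_min {f : ℝ → ℝ} {a b c : ℝ} (hab : a < b) (hbc : b < c)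
    (hf : ContinuousOn f (Ioo a c)) (hneg : ∀ u ∈ Ioo a b, deriv f u < 0)
    (hpos : ∀ u ∈ Ioo b c, 0 < deriv f u) :
    ∃ γ > 0, ∀ u : ℝ, u ≠ b → |u - b| < γ → f b < f u := by
  refine ⟨min (b - a) (c - b), lt_min (sub_pos.2 hab) (sub_pos.2 hbc), fun u hu hub => ?_⟩
  obtain ⟨h1, h2⟩ := lt_min_iff.1 hub
  have h1 := (abs_lt.1 h1).1
  have h2 := (abs_lt.1 h2).2
  rcases lt_or_gt_of_ne hu with h | h
  · have hanti : StrictAntiOn f (Ioc a b) := by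
      refine strictAntiOn_of_deriv_neg (convex_Ioc a b)
        (hf.mono fun x hx => ⟨hx.1, hx.2.trans_lt hbc⟩) ?_
      simpa using hneg
    exact hanti ⟨by linarith, h.le⟩ ⟨hab, le_rfl⟩ h
  · have hmono : StrictMonoOn f (Ico b c) := by
      refine strictMonoOn_of_deriv_pos (convex_Ico b c)
        (hf.mono fun x hx => ⟨hab.trans_le hx.1, hx.2⟩) ?_
      simpa using hpos
    exact hmono ⟨le_rfl, hbc⟩ ⟨h.le, by linarith⟩ h

/-- Suppose `W` is `C²` with `W'(0) < 0 < W''(0) - W'(0)`, and set `r₀ = √(-8 W'(0))`.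
(a) For `r > r₀` the origin is the only critical point of `U_r` near `0`.
(b) For `r` slightly below `r₀` a branch `β(r)` of strict local minima of `U_r` bifurcates
off the origin, depending continuously on `r` and tending to `0` as `r → r₀⁻`. -/
theorem effU_hopf_bifurcation_subcritical (ε : ℝ) (hε : 0 < ε) (W : ℝ → ℝ)
    (hW : ContDiffOn ℝ 2 W (Set.Ioo (-ε) 1))
    (hW1 : deriv W 0 < 0) (hW2 : deriv W 0 < deriv (deriv W) 0)
    (r₀ : ℝ) (hr₀ : r₀ = Real.sqrt (-8 * deriv W 0)) :
    ∃ η > 0,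
      (∀ r : ℝ, r₀ < r → ∀ u : ℝ, 0 < |u| → |u| < η → deriv (effU r W) u ≠ 0) ∧
      ∃ δ > 0, ∃ β : ℝ → ℝ,
        ContinuousOn β (Set.Ioo (r₀ - δ) r₀) ∧
        (∀ r ∈ Set.Ioo (r₀ - δ) r₀,
          β r ∈ Set.Ioo 0 η ∧
          deriv (effU r W) (β r) = 0 ∧
          ∃ γ > 0, ∀ u : ℝ, u ≠ β r → |u - β r| < γ → effU r W (β r) < effU r W u) ∧
        Filter.Tendsto β (nhdsWithin r₀ (Set.Iio r₀)) (nhds 0) := by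
  have hdW : ContDiffOn ℝ 1 (deriv W) (Ioo (-ε) 1) := hW.deriv_of_isOpen isOpen_Ioo (by norm_num)
  have h0 : (0 : ℝ) ∈ Ioo (-ε) 1 := ⟨by linarith, one_pos⟩
  obtain ⟨a, ha, hanti⟩ := (hasStrictDerivAt_criticalSq
    (hdW.contDiffAt (isOpen_Ioo.mem_nhds h0))).exists_strictAntiOn (by linarith)
  rw [zero_sub, zero_add] at hanti
  obtain ⟨η, hη, hηa, hη1⟩ : ∃ η > 0, η < a ∧ η < 1 := by
    obtain ⟨η, h1, h2⟩ := exists_between (lt_min ha one_pos)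
    exact ⟨η, h1, lt_min_iff.1 h2⟩
  have hsq : ∀ u : ℝ, |u| ≤ η → u ^ 2 ∈ Ioo (-a) a ∧ u ^ 2 ∈ Ioo (-ε) 1 := fun u hu => by
    have h1 : u ^ 2 ≤ η := by
      rw [← sq_abs]
      nlinarith [abs_nonneg u]
    have h2 := sq_nonneg u
    exact ⟨⟨by linarith, by linarith⟩, by linarith, by linarith⟩
  have hderiv : ∀ r u : ℝ, |u| ≤ η → HasDerivAt (effU r W) (u * (r ^ 2 - criticalSq W (u ^ 2)) /
      (√(1 - u ^ 2) * (1 + √(1 - u ^ 2)) ^ 2)) u := fun r u hu =>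
    hasDerivAt_effU (hu.trans_lt hη1)
      ((hW.contDiffAt (isOpen_Ioo.mem_nhds (hsq u hu).2)).differentiableAt (by norm_num))
  have hden : ∀ u : ℝ, |u| ≤ η → 0 < √(1 - u ^ 2) * (1 + √(1 - u ^ 2)) ^ 2 := fun u hu => by
    have : 0 < √(1 - u ^ 2) := Real.sqrt_pos.2 (by linarith [(hsq u hu).2.2])
    positivity
  have hr₀_pos : 0 < r₀ := hr₀ ▸ Real.sqrt_pos.2 (by linarith)
  have hG0 : criticalSq W 0 = r₀ ^ 2 := by
    rw [hr₀, Real.sq_sqrt (by linarith), criticalSq]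
    norm_num
    ring
  have habs : ∀ u ∈ Icc 0 η, |u| ≤ η := fun u hu => (abs_of_nonneg hu.1).trans_le hu.2
  set G : ℝ → ℝ := fun u => criticalSq W (u ^ 2) with hG
  have hGanti : StrictAntiOn G (Icc 0 η) := fun x hx y hy hxy =>
    hanti (hsq x (habs x hx)).1 (hsq y (habs y hy)).1 (pow_lt_pow_left₀ hxy hx.1 two_ne_zero)
  have hGcont : ContinuousOn G (Icc 0 η) := by
    have h1 : ContinuousOn (fun u : ℝ => deriv W (u ^ 2)) (Icc 0 η) :=
      hdW.continuousOn.comp (by fun_prop) fun u hu => (hsq u (habs u hu)).2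
    simp only [hG, criticalSq]
    fun_prop
  have hGzero : G 0 = r₀ ^ 2 := by simp [hG, hG0]
  refine ⟨η, hη, fun r hr u hu0 huη => ?_, ?_⟩
  · have hlt : criticalSq W (u ^ 2) < r ^ 2 := calc
      criticalSq W (u ^ 2) < criticalSq W 0 :=
        hanti ⟨by linarith, ha⟩ (hsq u huη.le).1 (sq_pos_of_ne_zero (abs_pos.1 hu0))
      _ = r₀ ^ 2 := hG0
      _ < r ^ 2 := pow_lt_pow_left₀ hr hr₀_pos.le two_ne_zero
    rw [(hderiv r u huη.le).deriv]
    exact div_ne_zero (mul_ne_zero (abs_pos.1 hu0) (sub_pos.2 hlt).ne') (hden u huη.le).ne'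
  · obtain ⟨b, hbc, hb, hbt⟩ := hGanti.exists_continuousOn_inverse hη hGcont
    rw [hGzero] at hbc hb hbt
    have hGη : G η < r₀ ^ 2 := hGzero ▸ hGanti ⟨le_rfl, hη.le⟩ ⟨hη.le, le_rfl⟩ hη
    have hm : √(max (G η) 0) < r₀ :=
      (Real.sqrt_lt' hr₀_pos).2 (max_lt hGη (by positivity))
    have hmaps : MapsTo (fun r : ℝ => r ^ 2) (Ioo √(max (G η) 0) r₀) (Ioo (G η) (r₀ ^ 2)) :=
      fun r hr => by
        have hr0 : 0 < r := (Real.sqrt_nonneg _).trans_lt hr.1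
        exact ⟨(le_max_left _ _).trans_lt ((Real.sqrt_lt' hr0).1 hr.1),
          pow_lt_pow_left₀ hr.2 hr0.le two_ne_zero⟩
    refine ⟨r₀ - √(max (G η) 0), sub_pos.2 hm, fun r => b (r ^ 2), ?_⟩
    rw [sub_sub_cancel]
    refine ⟨hbc.comp (by fun_prop) hmaps, fun r hr => ?_, ?_⟩
    · obtain ⟨hbr, hGb⟩ : b (r ^ 2) ∈ Ioo 0 η ∧ G (b (r ^ 2)) = r ^ 2 := hb _ (hmaps hr)
      refine ⟨hbr, ?_, ?_⟩
      · rw [(hderiv r _ (habs _ (Ioo_subset_Icc_self hbr))).deriv]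
        have : criticalSq W (b (r ^ 2) ^ 2) = r ^ 2 := hGb
        simp [this]
      · refine exists_strict_local_min hbr.1 hbr.2 (fun u hu =>
          (hderiv r u (habs u (Ioo_subset_Icc_self hu))).continuousAt.continuousWithinAt)
          (fun u hu => ?_) (fun u hu => ?_)
        · have hmem : u ∈ Icc 0 η := ⟨hu.1.le, hu.2.le.trans hbr.2.le⟩
          have hlt : r ^ 2 < G u := hGb.symm.trans_lt (hGanti hmem (Ioo_subset_Icc_self hbr) hu.2)
          rw [(hderiv r u (habs u hmem)).deriv]
          exact div_neg_of_neg_of_pos (mul_neg_of_pos_of_neg hu.1 (sub_neg.2 hlt))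
            (hden u (habs u hmem))
        · have hmem : u ∈ Icc 0 η := ⟨hbr.1.le.trans hu.1.le, hu.2.le⟩
          have hlt : G u < r ^ 2 := (hGanti (Ioo_subset_Icc_self hbr) hmem hu.1).trans_eq hGb
          rw [(hderiv r u (habs u hmem)).deriv]
          exact div_pos (mul_pos (hbr.1.trans hu.1) (sub_pos.2 hlt)) (hden u (habs u hmem))
    · refine hbt.comp (tendsto_nhdsWithin_iff.2 ⟨?_, ?_⟩)
      · exact ((continuous_pow 2).tendsto r₀).mono_left nhdsWithin_le_nhds
      · filter_upwards [Ioo_mem_nhdsLT hm] with r hr using (hmaps hr).2
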